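/- There exists ε > 0 such that for all real x with |x| < ε, F(5/24, 13/24; 5/4; 108·x·(x-1)^4 / (x^2+14x+1)^3) = (1 / (1-x)) · (1+14x+x^2)^(5/8). -/

import Mathlib

open Real

/-- The Gauss hypergeometric series `F(a,b;c;z) = ∑ ((a)_n (b)_n / ((c)_n n!)) z^n`,
where `(q)_n` is the rising (Pochhammer) factorial. -/
noncomputable def hypgeo (a b c z : ℝ) : ℝ :=
  ∑' n : ℕ, ((∏ i ∈ Finset.range n, (a + i)) * (∏ i ∈ Finset.range n, (b + i)) /
    ((∏ i ∈ Finset.range n, (c + i)) * (Nat.factorial n))) * z ^ n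

open Filter Topology

theorem hasFPowerSeriesOnBall_ofScalars_of_hasSum {c : ℕ → ℝ} {f : ℝ → ℝ}
    (h : ∀ z : ℝ, |z| < 1 → HasSum (fun n => c n * z ^ n) (f z)) :
    HasFPowerSeriesOnBall f (FormalMultilinearSeries.ofScalars ℝ c) 0 1 where
  r_le := by
    refine ENNReal.le_of_forall_nnreal_lt fun r hr => ?_
    refine FormalMultilinearSeries.le_radius_of_tendsto _ (l := 0) ?_
    have hr' : |(r : ℝ)| < 1 := by
      rw [NNReal.abs_eq]
      exact_mod_cast hr
    have h0 := (h r hr').summable.tendsto_atTop_zero.norm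
    simpa [FormalMultilinearSeries.ofScalars_norm, norm_mul, norm_pow] using h0
  r_pos := one_pos
  hasSum := by
    intro y hy
    have hy' : |y| < 1 := by
      simpa [edist_zero_right, ← ofReal_norm] using hy
    simpa [FormalMultilinearSeries.ofScalars_apply_eq, mul_comm] using h y hy'

theorem hasSum_mul_deriv_of_hasSum {c : ℕ → ℝ} {f : ℝ → ℝ}
    (h : ∀ z : ℝ, |z| < 1 → HasSum (fun n => c n * z ^ n) (f z)) {z : ℝ} (hz : |z| < 1) :
    HasSum (fun n : ℕ => n * c n * z ^ n) (z * deriv f z) := by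
  have hz' : z ∈ Metric.eball (0 : ℝ) 1 := by
    simpa [edist_zero_right, ← ofReal_norm] using hz
  have h1 := (hasFPowerSeriesOnBall_ofScalars_of_hasSum h).fderiv.hasSum hz'
  have h2 := h1.mapL (ContinuousLinearMap.apply ℝ ℝ z)
  simp only [ContinuousLinearMap.apply_apply, FormalMultilinearSeries.derivSeries_apply_diag,
    FormalMultilinearSeries.ofScalars_apply_eq, zero_add] at h2
  rw [← hasSum_nat_add_iff' 1]
  convert h2 using 1
  · ext n
    simp
    ring
  · have : (fderiv ℝ f z) z = z * deriv f z := by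
      rw [← fderiv_apply_one_eq_deriv]
      simp
    simp [this]

/-- The coefficients of the hypergeometric series. -/
noncomputable def hypgeoCoeff (a b c : ℝ) (n : ℕ) : ℝ :=
  (∏ i ∈ Finset.range n, (a + i)) * (∏ i ∈ Finset.range n, (b + i)) /
    ((∏ i ∈ Finset.range n, (c + i)) * (Nat.factorial n))

theorem hypgeoCoeff_succ {a b c : ℝ} (hc : 0 < c) (n : ℕ) :
    (n + 1) * (c + n) * hypgeoCoeff a b c (n + 1) = (a + n) * (b + n) * hypgeoCoeff a b c n := by
  have hcn : c + n ≠ 0 := by positivity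
  have hp : ∏ i ∈ Finset.range n, (c + (i : ℝ)) ≠ 0 :=
    Finset.prod_ne_zero_iff.2 fun i _ => by positivity
  have hf : (n.factorial : ℝ) ≠ 0 := by positivity
  have hn : (n : ℝ) + 1 ≠ 0 := by positivity
  simp only [hypgeoCoeff, Finset.prod_range_succ, Nat.factorial_succ]
  push_cast
  field_simp

theorem hypgeoCoeff_mem_Icc {a b c : ℝ} (ha : 0 < a) (hac : a ≤ c) (hb : 0 < b) (hb1 : b ≤ 1)
    (n : ℕ) : hypgeoCoeff a b c n ∈ Set.Icc 0 1 := by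
  have hc : 0 < c := ha.trans_le hac
  induction n with
  | zero => simp [hypgeoCoeff]
  | succ n ih =>
    have hcn : 0 < (n + 1) * (c + n) := by positivity
    have h := hypgeoCoeff_succ (a := a) (b := b) hc n
    have hab : (a + n) * (b + n) ≤ (n + 1) * (c + n) := by
      rw [mul_comm]
      apply mul_le_mul <;> linarith
    constructor
    · have : 0 ≤ (n + 1) * (c + n) * hypgeoCoeff a b c (n + 1) := by
        rw [h]
        exact mul_nonneg (by positivity) ih.1
      exact nonneg_of_mul_nonneg_right this hcn
    · refine le_of_mul_le_mul_left ?_ hcn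
      rw [h]
      exact mul_le_mul hab ih.2 ih.1 hcn.le

theorem hasSum_hypgeo {a b c : ℝ} (ha : 0 < a) (hac : a ≤ c) (hb : 0 < b) (hb1 : b ≤ 1)
    {z : ℝ} (hz : |z| < 1) :
    HasSum (fun n => hypgeoCoeff a b c n * z ^ n) (hypgeo a b c z) := by
  refine Summable.hasSum (f := fun n => hypgeoCoeff a b c n * z ^ n) ?_
  refine Summable.of_norm_bounded (summable_geometric_of_lt_one (abs_nonneg z) hz) fun n => ?_
  have h := hypgeoCoeff_mem_Icc ha hac hb hb1 n
  rw [norm_mul, norm_pow, Real.norm_of_nonneg h.1, Real.norm_eq_abs]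
  exact mul_le_of_le_one_left (by positivity) h.2

/-- The hypergeometric differential equation, in terms of the Euler operator `z d/dz`. -/
theorem hypgeo_euler_equation {a b c : ℝ} (ha : 0 < a) (hac : a ≤ c) (hb : 0 < b) (hb1 : b ≤ 1)
    {f₁ : ℝ → ℝ} (hf₁ : f₁ = fun z => z * deriv (hypgeo a b c) z)
    {z : ℝ} (hz : |z| < 1) :
    z * deriv f₁ z + (c - 1) * f₁ z =
      z * (z * deriv f₁ z + (a + b) * f₁ z + a * b * hypgeo a b c z) := by
  have h0 := fun z hz => hasSum_hypgeo ha hac hb hb1 (z := z) hz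
  have h1 : ∀ z : ℝ, |z| < 1 → HasSum (fun n : ℕ => n * hypgeoCoeff a b c n * z ^ n) (f₁ z) := by
    rw [hf₁]
    exact fun z hz => hasSum_mul_deriv_of_hasSum h0 hz
  have h2 := hasSum_mul_deriv_of_hasSum h1 hz
  have hl := h2.add ((h1 z hz).mul_left (c - 1))
  have hr := ((h2.add ((h1 z hz).mul_left (a + b))).add ((h0 z hz).mul_left (a * b))).mul_left z
  rw [← hasSum_nat_add_iff' 1] at hl
  simp only [Finset.range_one, Finset.sum_singleton, Nat.cast_zero, zero_mul, mul_zero, add_zero,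
    sub_zero] at hl
  refine hl.unique ?_
  convert! hr using 1
  ext n
  have h := hypgeoCoeff_succ (a := a) (b := b) (ha.trans_le hac) n
  push_cast
  linear_combination z ^ (n + 1) * h

theorem exists_analyticAt_of_eventually_mul_deriv_eq {D E ρ g : ℝ → ℝ} {n : ℕ}
    (hg : AnalyticAt ℝ g 0) (hD : ∀ᶠ x in 𝓝 0, D x = x ^ n * g x)
    (hρ : AnalyticAt ℝ ρ 0) (hρ0 : ρ 0 ≠ 0)
    (hE : ∀ᶠ x in 𝓝 0, x * deriv D x = ρ x * E x) :
    ∃ k : ℝ → ℝ, AnalyticAt ℝ k 0 ∧ k 0 = n * g 0 / ρ 0 ∧ ∀ᶠ x in 𝓝 0, E x = x ^ n * k x := by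
  refine ⟨fun x => (n * g x + x * deriv g x) / ρ x, ?_, by simp, ?_⟩
  · exact ((analyticAt_const.mul hg).add (analyticAt_id.mul hg.deriv)).div hρ hρ0
  · filter_upwards [hE, hD.eventually_nhds, hg.eventually_analyticAt,
      hρ.continuousAt.eventually_ne hρ0] with x hx hDx hgx hρx
    have hd : HasDerivAt D (n * x ^ (n - 1) * g x + x ^ n * deriv g x) x :=
      ((hasDerivAt_pow n x).mul hgx.differentiableAt.hasDerivAt).congr_of_eventuallyEq hDx
    rw [hd.deriv] at hx
    have hpow : x * (n * x ^ (n - 1)) = n * x ^ n := by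
      cases n with
      | zero => simp
      | succ m => simp only [Nat.add_sub_cancel, pow_succ]; ring
    field_simp
    linear_combination -hx + g x * hpow

/-- The only analytic solution vanishing at the regular singular point `0` of a pulled back
hypergeometric equation is zero. -/
theorem eventually_eq_zero_of_euler_system {D₀ D₁ D₂ ρ φ : ℝ → ℝ} {c s t : ℝ} (hc : 0 < c)
    (hD : AnalyticAt ℝ D₀ 0) (hD0 : D₀ 0 = 0)
    (hρ : AnalyticAt ℝ ρ 0) (hρ0 : ρ 0 = 1) (hφ : ContinuousAt φ 0) (hφ0 : φ 0 = 0)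
    (h1 : ∀ᶠ x in 𝓝 0, x * deriv D₀ x = ρ x * D₁ x)
    (h2 : ∀ᶠ x in 𝓝 0, x * deriv D₁ x = ρ x * D₂ x)
    (h : ∀ᶠ x in 𝓝 0, D₂ x + (c - 1) * D₁ x = φ x * (D₂ x + s * D₁ x + t * D₀ x)) :
    ∀ᶠ x in 𝓝 0, D₀ x = 0 := by
  by_contra hne
  obtain ⟨n, g, hg, hg0, hDg⟩ := hD.exists_eventuallyEq_pow_smul_nonzero_iff.2 hne
  simp only [sub_zero, smul_eq_mul] at hDg
  have hn : n ≠ 0 := by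
    rintro rfl
    have := hDg.self_of_nhds
    simp_all
  have hρ1 : ρ 0 ≠ 0 := by simp [hρ0]
  obtain ⟨g₁, hg₁, hg₁0, hD₁⟩ := exists_analyticAt_of_eventually_mul_deriv_eq hg hDg hρ hρ1 h1
  obtain ⟨g₂, hg₂, hg₂0, hD₂⟩ := exists_analyticAt_of_eventually_mul_deriv_eq hg₁ hD₁ hρ hρ1 h2
  have hlim : ContinuousAt
      (fun x => g₂ x + (c - 1) * g₁ x - φ x * (g₂ x + s * g₁ x + t * g x)) 0 := by
    have := hg.continuousAt
    have := hg₁.continuousAt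
    have := hg₂.continuousAt
    fun_prop
  have hzero : ∀ᶠ x in 𝓝[≠] (0 : ℝ),
      g₂ x + (c - 1) * g₁ x - φ x * (g₂ x + s * g₁ x + t * g x) = 0 := by
    filter_upwards [hDg.filter_mono nhdsWithin_le_nhds, hD₁.filter_mono nhdsWithin_le_nhds,
      hD₂.filter_mono nhdsWithin_le_nhds, h.filter_mono nhdsWithin_le_nhds,
      self_mem_nhdsWithin] with x e0 e1 e2 e hx
    rw [e0, e1, e2] at e
    refine (mul_eq_zero.1 ?_).resolve_left (pow_ne_zero n hx)
    linear_combination e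
  have hlead := tendsto_nhds_unique (hlim.mono_left (nhdsWithin_le_nhds (s := {0}ᶜ)))
    (tendsto_const_nhds.congr' (hzero.mono fun x hx => hx.symm))
  simp only [hg₂0, hg₁0, hφ0, hρ0] at hlead
  have hn1 : (1 : ℝ) ≤ n := by exact_mod_cast Nat.one_le_iff_ne_zero.2 hn
  have hfac : (n * (n - 1 + c)) * g 0 = 0 := by linear_combination hlead
  rcases mul_eq_zero.1 hfac with h' | h'
  · have : 0 < (n : ℝ) * (n - 1 + c) := mul_pos (by linarith) (by linarith)
    linarith
  · exact hg0 h'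

theorem hypgeo_zero (a b c : ℝ) : hypgeo a b c 0 = 1 := by
  rw [hypgeo, tsum_eq_single 0]
  · simp
  · intro n hn
    simp [hn]

theorem stmt9 : ∃ ε > 0, ∀ x : ℝ, |x| < ε →
    hypgeo (5/24) (13/24) (5/4) (108 * x * (x - 1)^4 / (x^2 + 14*x + 1)^3) =
      (1 / (1 - x)) * (1 + 14*x + x^2) ^ ((5 : ℝ)/8) := by
  set F := hypgeo (5/24) (13/24) (5/4) with hF
  set φ : ℝ → ℝ := fun x => 108 * x * (x - 1)^4 / (x^2 + 14*x + 1)^3 with hφ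
  set G : ℝ → ℝ := fun x => (1 / (1 - x)) * (1 + 14*x + x^2) ^ ((5 : ℝ)/8) with hG
  set ρ : ℝ → ℝ := fun x =>
    (1 + x) * (1 - 34*x + x^2) / ((1 - x) * (1 + 14*x + x^2)) with hρ
  set r : ℝ → ℝ := fun x => x * (39 + 26*x - x^2) / (4 * ((1 + x) * (1 - 34*x + x^2))) with hr
  set r' : ℝ → ℝ := fun x =>
    ((39 + 52*x - 3*x^2) * ((1 + x) * (1 - 34*x + x^2)) -
      x * (39 + 26*x - x^2) * (-33 - 66*x + 3*x^2)) /
      (4 * ((1 + x) * (1 - 34*x + x^2))^2) with hr'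
  set F₁ : ℝ → ℝ := fun z => z * deriv F z with hF₁
  have hsum : ∀ z : ℝ, |z| < 1 → HasSum _ (F z) := fun z hz =>
    hasSum_hypgeo (a := 5/24) (b := 13/24) (c := 5/4) (by norm_num) (by norm_num) (by norm_num)
      (by norm_num) hz
  have hFan : ∀ z : ℝ, |z| < 1 → AnalyticAt ℝ F z := fun z hz =>
    (hasFPowerSeriesOnBall_ofScalars_of_hasSum hsum).analyticAt_of_mem
      (by simpa [edist_zero_right, ← ofReal_norm] using hz)
  have hF₁an : ∀ z : ℝ, |z| < 1 → AnalyticAt ℝ F₁ z := fun z hz =>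
    analyticAt_id.mul (hFan z hz).deriv
  have hφ0 : φ 0 = 0 := by simp [hφ]
  have hφan : AnalyticAt ℝ φ 0 := by
    refine AnalyticAt.div (by fun_prop) (by fun_prop) (by norm_num)
  have hρan : AnalyticAt ℝ ρ 0 := by
    refine AnalyticAt.div (by fun_prop) (by fun_prop) (by norm_num)
  have e1 : ∀ᶠ x : ℝ in 𝓝 0, 0 < 1 - x :=
    continuousAt_const.eventually_lt (by fun_prop) (by norm_num)
  have e2 : ∀ᶠ x : ℝ in 𝓝 0, 0 < 1 + 14*x + x^2 :=
    continuousAt_const.eventually_lt (by fun_prop) (by norm_num)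
  have e3 : ∀ᶠ x : ℝ in 𝓝 0, 0 < 1 + x :=
    continuousAt_const.eventually_lt (by fun_prop) (by norm_num)
  have e4 : ∀ᶠ x : ℝ in 𝓝 0, 0 < 1 - 34*x + x^2 :=
    continuousAt_const.eventually_lt (by fun_prop) (by norm_num)
  have e5 : ∀ᶠ x : ℝ in 𝓝 0, |φ x| < 1 :=
    hφan.continuousAt.abs.eventually_lt continuousAt_const (by simp [hφ0])
  have hGan : AnalyticAt ℝ G 0 := by
    refine AnalyticAt.mul (AnalyticAt.div (by fun_prop) (by fun_prop) (by norm_num)) ?_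
    have hS : AnalyticAt ℝ (fun x : ℝ => 1 + 14*x + x^2) 0 := by fun_prop
    refine ((hS.log (by norm_num)).mul analyticAt_const).rexp.congr (f := fun x =>
      Real.exp (Real.log (1 + 14*x + x^2) * (5/8))) ?_
    filter_upwards [e2] with x h2
    rw [Real.rpow_def_of_pos h2]
  have dφ : ∀ x, 0 < 1 - x → 0 < 1 + 14*x + x^2 →
      ∃ d, HasDerivAt φ d x ∧ x * d = ρ x * φ x := by
    intro x h1 h2
    have h2' : x^2 + 14*x + 1 ≠ 0 := by linarith
    have hN : HasDerivAt (fun x : ℝ => 108 * x * (x - 1)^4)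
        (108 * (x - 1)^4 + 108 * x * (4 * (x - 1)^3)) x := by
      convert! ((hasDerivAt_id x).const_mul 108).mul (((hasDerivAt_id x).sub_const 1).pow 4)
        using 1
      simp
    have hM : HasDerivAt (fun x : ℝ => (x^2 + 14*x + 1)^3)
        (3 * (x^2 + 14*x + 1)^2 * (2 * x + 14)) x := by
      convert! (((hasDerivAt_pow 2 x).add ((hasDerivAt_id x).const_mul 14)).add_const 1).pow 3
        using 1
      simp
    refine ⟨_, hN.div hM (pow_ne_zero 3 h2'), ?_⟩
    have hS : x^2 + 14*x + 1 = 1 + 14*x + x^2 := by ring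
    simp only [hφ, hρ, hS]
    obtain ⟨S, hS⟩ : ∃ S, S = 1 + 14*x + x^2 := ⟨_, rfl⟩
    obtain ⟨u, hu⟩ : ∃ u, u = 1 - x := ⟨_, rfl⟩
    have hxu : x - 1 = -u := by linarith
    rw [← hu] at h1
    rw [← hS] at h2
    simp only [← hS, ← hu, hxu]
    field_simp
    subst hS hu
    ring
  have dG : ∀ x, 0 < 1 - x → 0 < 1 + 14*x + x^2 → 0 < 1 + x → 0 < 1 - 34*x + x^2 →
      ∃ d, HasDerivAt G d x ∧ x * d = ρ x * (r x * G x) := by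
    intro x h1 h2 h3 h4
    have hS' : HasDerivAt (fun x : ℝ => 1 + 14*x + x^2) (14 + 2 * x) x := by
      convert! (((hasDerivAt_id x).const_mul 14).const_add 1).add (hasDerivAt_pow 2 x) using 1
      simp
    have hI : HasDerivAt (fun x : ℝ => 1 / (1 - x)) (1 / (1 - x)^2) x := by
      simpa [Pi.inv_def] using ((hasDerivAt_id x).const_sub 1).inv h1.ne'
    refine ⟨_, hI.mul (hS'.rpow_const (p := 5/8) (Or.inl h2.ne')), ?_⟩
    rw [Real.rpow_sub_one h2.ne']
    simp only [hG, hρ, hr]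
    generalize (1 + 14*x + x^2) ^ ((5 : ℝ)/8) = P
    obtain ⟨S, hS⟩ : ∃ S, S = 1 + 14*x + x^2 := ⟨_, rfl⟩
    obtain ⟨u, hu⟩ : ∃ u, u = 1 - x := ⟨_, rfl⟩
    obtain ⟨v, hv⟩ : ∃ v, v = 1 + x := ⟨_, rfl⟩
    obtain ⟨R, hR⟩ : ∃ R, R = 1 - 34*x + x^2 := ⟨_, rfl⟩
    rw [← hu] at h1
    rw [← hS] at h2
    rw [← hv] at h3
    rw [← hR] at h4
    simp only [← hS, ← hu, ← hv, ← hR]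
    field_simp
    subst hS hu
    ring
  have dr : ∀ x, 0 < 1 + x → 0 < 1 - 34*x + x^2 → HasDerivAt r (r' x) x := by
    intro x h3 h4
    have h3' := h3.ne'
    have h4' := h4.ne'
    have hN : HasDerivAt (fun x : ℝ => x * (39 + 26*x - x^2)) (39 + 52*x - 3*x^2) x := by
      convert! (hasDerivAt_id x).mul ((((hasDerivAt_id x).const_mul 26).const_add 39).sub
        (hasDerivAt_pow 2 x)) using 1
      simp
      ring
    have hM : HasDerivAt (fun x : ℝ => 4 * ((1 + x) * (1 - 34*x + x^2)))
        (4 * (-33 - 66*x + 3*x^2)) x := by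
      convert! (((hasDerivAt_id x).const_add 1).mul
        ((((hasDerivAt_id x).const_mul 34).const_sub 1).add (hasDerivAt_pow 2 x))).const_mul 4
        using 1
      simp
      ring
    convert! hN.div hM (by positivity) using 1
    simp only [hr']
    field_simp
  have key := eventually_eq_zero_of_euler_system (c := 5/4) (s := 5/24 + 13/24)
    (t := 5/24 * (13/24)) (D₀ := fun x => F (φ x) - G x) (D₁ := fun x => F₁ (φ x) - r x * G x)
    (D₂ := fun x => φ x * deriv F₁ (φ x) - (x * r' x / ρ x + r x ^ 2) * G x) (ρ := ρ) (φ := φ)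
    (by norm_num)
    (((hFan _ (by simp [hφ0])).comp hφan).sub hGan)
    (by simp [hφ0, hF, hypgeo_zero, hG]) hρan (by simp [hρ]) hφan.continuousAt hφ0
    (by
      filter_upwards [e1, e2, e3, e4, e5] with x h1 h2 h3 h4 h5
      obtain ⟨d, hd, hdx⟩ := dφ x h1 h2
      obtain ⟨k, hk, hkx⟩ := dG x h1 h2 h3 h4
      have := ((hFan _ h5).differentiableAt.hasDerivAt.comp x hd).sub hk
      erw [this.deriv]
      simp only [hF₁]
      linear_combination deriv F (φ x) * hdx - hkx)
    (by
      filter_upwards [e1, e2, e3, e4, e5] with x h1 h2 h3 h4 h5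
      obtain ⟨d, hd, hdx⟩ := dφ x h1 h2
      obtain ⟨k, hk, hkx⟩ := dG x h1 h2 h3 h4
      have := ((hF₁an _ h5).differentiableAt.hasDerivAt.comp x hd).sub ((dr x h3 h4).mul hk)
      erw [this.deriv]
      have hρx : ρ x ≠ 0 := by simp only [hρ]; positivity
      have hcancel : ρ x * (x * r' x / ρ x) = x * r' x := by field_simp
      linear_combination deriv F₁ (φ x) * hdx - r x * hkx + G x * hcancel)
    (by
      filter_upwards [e1, e2, e3, e4, e5] with x h1 h2 h3 h4 h5
      have hode := hypgeo_euler_equation (a := 5/24) (b := 13/24) (c := 5/4) (by norm_num)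
        (by norm_num) (by norm_num) (by norm_num) hF₁ h5
      have hrat : (x * r' x / ρ x + r x ^ 2) + (5/4 - 1) * r x =
          φ x * ((x * r' x / ρ x + r x ^ 2) + (5/24 + 13/24) * r x + 5/24 * (13/24)) := by
        have hS : x^2 + 14*x + 1 = 1 + 14*x + x^2 := by ring
        simp only [hr', hρ, hr, hφ, hS]
        obtain ⟨S, hS⟩ : ∃ S, S = 1 + 14*x + x^2 := ⟨_, rfl⟩
        obtain ⟨u, hu⟩ : ∃ u, u = 1 - x := ⟨_, rfl⟩
        obtain ⟨v, hv⟩ : ∃ v, v = 1 + x := ⟨_, rfl⟩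
        obtain ⟨R, hR⟩ : ∃ R, R = 1 - 34*x + x^2 := ⟨_, rfl⟩
        have hxu : x - 1 = -u := by linarith
        rw [← hu] at h1
        rw [← hS] at h2
        rw [← hv] at h3
        rw [← hR] at h4
        simp only [← hS, ← hu, ← hv, ← hR, hxu]
        field_simp
        subst hS hu hv hR
        ring
      linear_combination hode - G x * hrat)
  obtain ⟨ε, hε, hball⟩ := Metric.eventually_nhds_iff.1 key
  exact ⟨ε, hε, fun x hx => sub_eq_zero.1 (hball (by simpa using hx))⟩
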